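/- arXiv:2603.13922 — 3 statements merged into one kernel-verified Lean document; each statement's English description precedes it below -/
import Mathlib

section
/- Let A, B ⊆ ℂ be nonempty convex sets, each invariant under complex conjugation. Then the set distance between A and B equals the set distance between their real-axis projections: d(A, B) = d(Re '' A, Re '' B), where Re '' A := {Re a : a ∈ A} ⊆ ℝ and the distance on the right is taken in ℝ. -/
/-- The distance between two sets in a metric space:
`d(A,B) := inf {dist a b : a ∈ A, b ∈ B}`. -/
noncomputable def setDist {X : Type*} [PseudoMetricSpace X] (A B : Set X) : ℝ :=
  sInf (Set.image2 dist A B)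

theorem re_mem_of_conj_convex (A : Set ℂ) (hAconv : Convex ℝ A)
    (hAconj : ∀ z ∈ A, (starRingEnd ℂ) z ∈ A) (z : ℂ) (hz : z ∈ A) : (z.re : ℂ) ∈ A := by
  have h := hAconv hz (hAconj z hz) (a := 1/2) (b := 1/2) (by norm_num) (by norm_num) (by norm_num)
  convert h using 1
  apply Complex.ext
  · simp; ring
  · simp

/-- For nonempty convex subsets `A, B ⊆ ℂ`, each invariant under complex
conjugation, the set distance between `A` and `B` (in ℂ) equals the set
distance (in ℝ) between their projections onto the real axis. -/
theorem setDist_eq_setDist_re_proj (A B : Set ℂ)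
    (hA : A.Nonempty) (hB : B.Nonempty)
    (hAconv : Convex ℝ A) (hBconv : Convex ℝ B)
    (hAconj : ∀ z ∈ A, (starRingEnd ℂ) z ∈ A)
    (hBconj : ∀ z ∈ B, (starRingEnd ℂ) z ∈ B) :
    setDist A B = setDist (Complex.re '' A) (Complex.re '' B) := by
  unfold setDist
  have bd : ∀ {X : Type} [PseudoMetricSpace X] (S T : Set X), BddBelow (Set.image2 dist S T) := by
    intro X _ S T
    refine ⟨0, ?_⟩
    rintro _ ⟨a, _, b, _, rfl⟩
    exact dist_nonneg
  apply le_antisymm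
  · refine le_csInf ((hA.image _).image2 (hB.image _)) ?_
    rintro _ ⟨_, ⟨a, ha, rfl⟩, _, ⟨b, hb, rfl⟩, rfl⟩
    refine csInf_le (bd A B) ⟨(a.re : ℂ), re_mem_of_conj_convex A hAconv hAconj a ha,
      (b.re : ℂ), re_mem_of_conj_convex B hBconv hBconj b hb, ?_⟩
    rw [Complex.dist_eq, ← Complex.ofReal_sub, Complex.norm_real, Real.dist_eq, Real.norm_eq_abs]
  · refine le_csInf (hA.image2 hB) ?_
    rintro _ ⟨a, ha, b, hb, rfl⟩
    refine (csInf_le (bd (Complex.re '' A) (Complex.re '' B)) ⟨a.re, ⟨a, ha, rfl⟩, b.re, ⟨b, hb, rfl⟩, rfl⟩).trans ?_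
    rw [Complex.dist_eq, Real.dist_eq, ← Complex.sub_re]
    exact Complex.abs_re_le_norm _
end

section
/- Let A, B ⊆ ℂ be nonempty convex sets, each invariant under complex conjugation, whose real-axis projections are closed intervals: Re '' A = [a̲, ā] and Re '' B = [b̲, b̄]. Define centers c_A = (a̲ + ā)/2, c_B = (b̲ + b̄)/2 and half-widths r_A = (ā − a̲)/2, r_B = (b̄ − b̲)/2. Then for any real scalars μ_A, μ_B, the set distance between the scaled sets A' := μ_A • A and B' := μ_B • B satisfies d(A', B') = max{0, |μ_A c_A − μ_B c_B| − (|μ_A| r_A + |μ_B| r_B)}. -/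
open Pointwise

theorem aux_real_mem (A : Set ℂ) (hAconv : Convex ℝ A)
    (hAconj : ∀ z ∈ A, (starRingEnd ℂ) z ∈ A) (alo ahi : ℝ)
    (hAproj : Complex.re '' A = Set.Icc alo ahi) (x : ℝ) (hx : x ∈ Set.Icc alo ahi) :
    (x : ℂ) ∈ A := by
  rw [← hAproj] at hx
  obtain ⟨z, hz, rfl⟩ := hx
  have h := hAconv hz (hAconj z hz) (a := 1/2) (b := 1/2) (by norm_num) (by norm_num) (by norm_num)
  convert h using 1
  apply Complex.ext
  · simp
    ring
  · simp

theorem aux_sign (m : ℝ) : ∃ s : ℝ, -1 ≤ s ∧ s ≤ 1 ∧ m * s = |m| := by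
  rcases le_total 0 m with h | h
  · exact ⟨1, by norm_num, by norm_num, by rw [abs_of_nonneg h]; ring⟩
  · exact ⟨-1, by norm_num, by norm_num, by rw [abs_of_nonpos h]; ring⟩

theorem aux_t (D R : ℝ) (hR : 0 ≤ R) :
    ∃ t : ℝ, -1 ≤ t ∧ t ≤ 1 ∧ |D - t * R| = max 0 (|D| - R) := by
  rcases le_or_gt |D| R with h | h
  · rw [max_eq_left (by linarith)]
    rcases hR.eq_or_lt with h0 | h0
    · subst h0
      exact ⟨0, by norm_num, by norm_num, by simpa using h⟩
    · have h2 := abs_le.1 h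
      refine ⟨D / R, ?_, ?_, ?_⟩
      · rw [le_div_iff₀ h0]; linarith
      · rw [div_le_iff₀ h0]; linarith
      · rw [div_mul_cancel₀ _ h0.ne']; simp
  · rw [max_eq_right (by linarith)]
    rcases le_total 0 D with h1 | h1
    · rw [abs_of_nonneg h1] at *
      exact ⟨1, by norm_num, by norm_num, by rw [abs_of_nonneg] <;> linarith⟩
    · rw [abs_of_nonpos h1] at *
      exact ⟨-1, by norm_num, by norm_num, by rw [abs_of_nonpos] <;> linarith⟩

theorem aux_Icc (l u s : ℝ) (hlu : l ≤ u) (h1 : -1 ≤ s) (h2 : s ≤ 1) :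
    (l + u) / 2 + s * ((u - l) / 2) ∈ Set.Icc l u :=
  ⟨by nlinarith, by nlinarith⟩

theorem aux_prod (s t : ℝ) (h1 : -1 ≤ s) (h2 : s ≤ 1) (h3 : -1 ≤ t) (h4 : t ≤ 1) :
    -1 ≤ s * t ∧ s * t ≤ 1 := by
  rw [← abs_le, abs_mul]
  exact mul_le_one₀ (abs_le.2 ⟨h1, h2⟩) (abs_nonneg _) (abs_le.2 ⟨h3, h4⟩)

theorem aux_dev (m x l u : ℝ) (hx : x ∈ Set.Icc l u) :
    |m * x - m * ((l + u) / 2)| ≤ |m| * ((u - l) / 2) := by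
  rw [← mul_sub, abs_mul]
  refine mul_le_mul_of_nonneg_left (abs_le.2 ⟨?_, ?_⟩) (abs_nonneg _) <;>
    linarith [hx.1, hx.2]

/-- **Distance for symmetric convex sets (Lemma "Distance for Symmetric Convex Sets").**
Let `A, B ⊆ ℂ` be nonempty convex sets, invariant under complex conjugation,
whose real-axis projections are the closed intervals `[alo, ahi]` and `[blo, bhi]`.
With centers `c_A = (alo+ahi)/2`, `c_B = (blo+bhi)/2` and half-widths
`r_A = (ahi−alo)/2`, `r_B = (bhi−blo)/2`, for any real scalars `μA, μB`,
`d(μA • A, μB • B) = max {0, |μA c_A − μB c_B| − (|μA| r_A + |μB| r_B)}`. -/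
theorem setDist_smul_symmetric_convex (A B : Set ℂ)
    (hA : A.Nonempty) (hB : B.Nonempty)
    (hAconv : Convex ℝ A) (hBconv : Convex ℝ B)
    (hAconj : ∀ z ∈ A, (starRingEnd ℂ) z ∈ A)
    (hBconj : ∀ z ∈ B, (starRingEnd ℂ) z ∈ B)
    (alo ahi blo bhi : ℝ)
    (hAproj : Complex.re '' A = Set.Icc alo ahi)
    (hBproj : Complex.re '' B = Set.Icc blo bhi)
    (μA μB : ℝ) :
    setDist (μA • A) (μB • B) =
      max 0 (|μA * ((alo + ahi) / 2) - μB * ((blo + bhi) / 2)| -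
        (|μA| * ((ahi - alo) / 2) + |μB| * ((bhi - blo) / 2))) := by
  have hal : alo ≤ ahi := by
    obtain ⟨z, hz⟩ := hA
    have h : z.re ∈ Set.Icc alo ahi := hAproj ▸ ⟨z, hz, rfl⟩
    exact h.1.trans h.2
  have hbl : blo ≤ bhi := by
    obtain ⟨z, hz⟩ := hB
    have h : z.re ∈ Set.Icc blo bhi := hBproj ▸ ⟨z, hz, rfl⟩
    exact h.1.trans h.2
  refine IsLeast.csInf_eq ⟨?_, ?_⟩
  · obtain ⟨s, hs1, hs2, hs⟩ := aux_sign μA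
    obtain ⟨r, hr1, hr2, hr⟩ := aux_sign μB
    obtain ⟨t, ht1, ht2, ht⟩ := aux_t (μA * ((alo + ahi) / 2) - μB * ((blo + bhi) / 2))
      (|μA| * ((ahi - alo) / 2) + |μB| * ((bhi - blo) / 2))
      (add_nonneg (mul_nonneg (abs_nonneg _) (by linarith))
        (mul_nonneg (abs_nonneg _) (by linarith)))
    have hp := aux_prod s (-t) hs1 hs2 (by linarith) (by linarith)
    have hq := aux_prod r t hr1 hr2 ht1 ht2
    have hx := aux_real_mem A hAconv hAconj alo ahi hAproj _ (aux_Icc alo ahi _ hal hp.1 hp.2)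
    have hy := aux_real_mem B hBconv hBconj blo bhi hBproj _ (aux_Icc blo bhi _ hbl hq.1 hq.2)
    refine ⟨_, Set.smul_mem_smul_set hx, _, Set.smul_mem_smul_set hy, ?_⟩
    rw [← ht, Complex.real_smul, Complex.real_smul, ← Complex.ofReal_mul, ← Complex.ofReal_mul,
      Complex.dist_eq, ← Complex.ofReal_sub, Complex.norm_real, Real.norm_eq_abs, ← hs, ← hr]
    congr 1
    ring
  · rintro _ ⟨_, ⟨z, hz, rfl⟩, _, ⟨w, hw, rfl⟩, rfl⟩
    refine max_le dist_nonneg ?_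
    have hz' : z.re ∈ Set.Icc alo ahi := hAproj ▸ ⟨z, hz, rfl⟩
    have hw' : w.re ∈ Set.Icc blo bhi := hBproj ▸ ⟨w, hw, rfl⟩
    have h1 := aux_dev μA z.re alo ahi hz'
    have h2 := aux_dev μB w.re blo bhi hw'
    have h3 : |μA * z.re - μB * w.re| ≤ dist (μA • z) (μB • w) := by
      rw [Complex.dist_eq]
      simpa using Complex.abs_re_le_norm (μA • z - μB • w)
    refine le_trans ?_ h3
    have h4 := abs_le.1 h1
    have h5 := abs_le.1 h2
    have h6 := abs_le.1 (le_refl |μA * z.re - μB * w.re|)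
    rw [sub_le_iff_le_add, abs_le]
    constructor <;> linarith [h4.1, h4.2, h5.1, h5.2, h6.1, h6.2]
end

section
/- Let A ⊆ ℂ and, for j = 1,…,n, let B_j ⊆ ℂ be nonempty convex sets, each invariant under complex conjugation, whose real-axis projections are closed intervals Re '' A = [a̲, ā] and Re '' B_j = [b̲_j, b̄_j], with centers c_A = (a̲+ā)/2, c_{B_j} = (b̲_j+b̄_j)/2 and half-widths r_A = (ā−a̲)/2, r_{B_j} = (b̄_j−b̲_j)/2. Then for any real scalars μ_A and μ_{B_1},…,μ_{B_n}, setting A' := μ_A • A and B' := (μ_{B_1} • B_1) ⊕ ⋯ ⊕ (μ_{B_n} • B_n) (Minkowski sum), one has d(A', B') = max{0, |μ_A c_A − Σ_{j=1}^n μ_{B_j} c_{B_j}| − (|μ_A| r_A + Σ_{j=1}^n |μ_{B_j}| r_{B_j})}. -/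
open Pointwise

theorem abs_sub_le_add (a b : ℝ) : |a - b| ≤ |a| + |b| := by
  simpa [sub_eq_add_neg] using abs_add_le a (-b)

def SymP (S : Set ℂ) (c r : ℝ) : Prop :=
  0 ≤ r ∧ (∀ z ∈ S, |z.re - c| ≤ r) ∧ ∀ x : ℝ, |x - c| ≤ r → (x : ℂ) ∈ S

theorem split_aux (t r s : ℝ) (hr : 0 ≤ r) (hs : 0 ≤ s) (h : |t| ≤ r + s) :
    ∃ u v : ℝ, |u| ≤ r ∧ |v| ≤ s ∧ t = u + v := by
  rw [abs_le] at h
  rcases le_total t (-r) with h1 | h1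
  · exact ⟨-r, t + r, by rw [abs_le]; constructor <;> linarith,
      by rw [abs_le]; constructor <;> linarith, by ring⟩
  · rcases le_total t r with h2 | h2
    · exact ⟨t, 0, by rw [abs_le]; constructor <;> linarith, by simpa using hs, by ring⟩
    · exact ⟨r, t - r, by rw [abs_le]; constructor <;> linarith,
        by rw [abs_le]; constructor <;> linarith, by ring⟩

theorem SymP.base {A : Set ℂ} (hA : A.Nonempty) (hc : Convex ℝ A)
    (hs : ∀ z ∈ A, (starRingEnd ℂ) z ∈ A) {lo hi : ℝ}
    (hp : Complex.re '' A = Set.Icc lo hi) : SymP A ((lo + hi) / 2) ((hi - lo) / 2) := by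
  have key : ∀ z ∈ A, lo ≤ z.re ∧ z.re ≤ hi := fun z hz => by
    have : z.re ∈ Complex.re '' A := ⟨z, hz, rfl⟩
    rw [hp] at this
    exact this
  refine ⟨?_, ?_, ?_⟩
  · obtain ⟨z, hz⟩ := hA
    have := key z hz
    linarith
  · intro z hz
    have := key z hz
    rw [abs_le]; constructor <;> linarith
  · intro x hx
    rw [abs_le] at hx
    have : x ∈ Complex.re '' A := by
      rw [hp]; constructor <;> linarith
    obtain ⟨z, hz, rfl⟩ := this
    have h := hc hz (hs z hz) (a := 1/2) (b := 1/2) (by norm_num) (by norm_num) (by norm_num)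
    convert h using 1
    apply Complex.ext
    · simp; ring
    · simp

theorem SymP.smul {S : Set ℂ} {c r : ℝ} (h : SymP S c r) (m : ℝ) :
    SymP (m • S) (m * c) (|m| * r) := by
  obtain ⟨h0, h1, h2⟩ := h
  refine ⟨by positivity, ?_, ?_⟩
  · rintro _ ⟨z, hz, rfl⟩
    have : (m • z).re - m * c = m * (z.re - c) := by simp; ring
    simp only [this, abs_mul]
    exact mul_le_mul_of_nonneg_left (h1 z hz) (abs_nonneg m)
  · intro x hx
    by_cases hm : m = 0
    · subst hm
      simp at hx
      subst hx
      exact ⟨c, h2 c (by simpa using h0), by simp⟩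
    · refine ⟨((x / m : ℝ) : ℂ), h2 _ ?_, ?_⟩
      · have e : x - m * c = m * (x / m - c) := by field_simp
        rw [e, abs_mul] at hx
        exact le_of_mul_le_mul_left hx (abs_pos.mpr hm)
      · have e : m * (x / m) = x := by field_simp
        simp only [Complex.real_smul]
        rw [← Complex.ofReal_mul, e]

theorem SymP.add {S T : Set ℂ} {c r d s : ℝ} (h : SymP S c r) (h' : SymP T d s) :
    SymP (S + T) (c + d) (r + s) := by
  obtain ⟨h0, h1, h2⟩ := h
  obtain ⟨k0, k1, k2⟩ := h'
  refine ⟨by positivity, ?_, ?_⟩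
  · rintro _ ⟨z, hz, w, hw, rfl⟩
    have e : (z + w).re - (c + d) = (z.re - c) + (w.re - d) := by simp; ring
    simp only [e]
    exact (abs_add_le _ _).trans (add_le_add (h1 z hz) (k1 w hw))
  · intro x hx
    obtain ⟨u, v, hu, hv, e⟩ := split_aux _ r s h0 k0 hx
    refine ⟨((c + u : ℝ) : ℂ), h2 _ (by simpa using hu), ((d + v : ℝ) : ℂ),
      k2 _ (by simpa using hv), ?_⟩
    have : x = (c + u) + (d + v) := by linarith
    rw [this]; push_cast; ring

theorem SymP.sum {ι : Type*} (F : Finset ι) (S : ι → Set ℂ) (c r : ι → ℝ)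
    (h : ∀ i, SymP (S i) (c i) (r i)) :
    SymP (∑ i ∈ F, S i) (∑ i ∈ F, c i) (∑ i ∈ F, r i) := by
  classical
  induction F using Finset.induction_on with
  | empty =>
    refine ⟨by simp, ?_, ?_⟩
    · intro z hz
      simp at hz
      simp [hz]
    · intro x hx
      simp at hx
      simp [hx]
  | insert a F ha ih =>
    rw [Finset.sum_insert ha, Finset.sum_insert ha, Finset.sum_insert ha]
    exact (h a).add ih

theorem SymP.setDist_eq {S T : Set ℂ} {c r d s : ℝ} (h : SymP S c r) (h' : SymP T d s) :
    setDist S T = max 0 (|c - d| - (r + s)) := by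
  obtain ⟨h0, h1, h2⟩ := h
  obtain ⟨k0, k1, k2⟩ := h'
  apply IsLeast.csInf_eq
  constructor
  · have : ∃ w : ℝ, |w| ≤ r + s ∧ |c - d + w| = max 0 (|c - d| - (r + s)) := by
      rcases le_total |c - d| (r + s) with hh | hh
      · refine ⟨-(c - d), by rwa [abs_neg], ?_⟩
        rw [max_eq_left (by linarith)]; simp
      · rw [max_eq_right (by linarith)]
        rcases le_total 0 (c - d) with g | g
        · rw [abs_of_nonneg g] at hh ⊢
          refine ⟨-(r + s), by rw [abs_neg, abs_of_nonneg (by linarith)], ?_⟩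
          rw [abs_of_nonneg (by linarith)]; ring
        · rw [abs_of_nonpos g] at hh ⊢
          refine ⟨r + s, by rw [abs_of_nonneg (by linarith)], ?_⟩
          rw [abs_of_nonpos (by linarith)]; ring
    obtain ⟨w, hw, e⟩ := this
    obtain ⟨u, v, hu, hv, rfl⟩ := split_aux w r s h0 k0 hw
    refine ⟨((c + u : ℝ) : ℂ), h2 _ (by simpa using hu), ((d - v : ℝ) : ℂ),
      k2 _ (by simpa using hv), ?_⟩
    rw [← e, Complex.dist_eq, ← Complex.ofReal_sub, Complex.norm_real, Real.norm_eq_abs]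
    congr 1; ring
  · rintro _ ⟨z, hz, w, hw, rfl⟩
    refine max_le dist_nonneg ?_
    have a1 := h1 z hz
    have a2 := k1 w hw
    have a3 : |z.re - w.re| ≤ dist z w := by
      rw [Complex.dist_eq, ← Complex.sub_re]
      exact Complex.abs_re_le_norm _
    have a4 : |c - d| ≤ |z.re - w.re| + (|z.re - c| + |w.re - d|) := by
      have e : c - d = (z.re - w.re) - ((z.re - c) - (w.re - d)) := by ring
      rw [e]
      exact (abs_sub_le_add _ _).trans (add_le_add le_rfl (abs_sub_le_add _ _))
    linarith

/-- **Extension of the symmetric-convex distance formula to multiple sets.**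
Let `A ⊆ ℂ` and `B j ⊆ ℂ` (for `j : Fin n`) be nonempty convex sets, each
invariant under complex conjugation, with real-axis projections the closed
intervals `[alo, ahi]` and `[blo j, bhi j]` respectively.  Then for real
scalars `μA` and `μB j`, with `A' := μA • A` and
`B' := (μB 1 • B 1) ⊕ ⋯ ⊕ (μB n • B n)` (Minkowski sum),
`d(A', B') = max {0, |μA c_A − Σ_j μB_j c_{B_j}| − (|μA| r_A + Σ_j |μB_j| r_{B_j})}`. -/
theorem setDist_smul_symmetric_convex_sum (n : ℕ) (A : Set ℂ) (B : Fin n → Set ℂ)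
    (hA : A.Nonempty) (hB : ∀ j, (B j).Nonempty)
    (hAconv : Convex ℝ A) (hBconv : ∀ j, Convex ℝ (B j))
    (hAconj : ∀ z ∈ A, (starRingEnd ℂ) z ∈ A)
    (hBconj : ∀ j, ∀ z ∈ B j, (starRingEnd ℂ) z ∈ B j)
    (alo ahi : ℝ) (blo bhi : Fin n → ℝ)
    (hAproj : Complex.re '' A = Set.Icc alo ahi)
    (hBproj : ∀ j, Complex.re '' (B j) = Set.Icc (blo j) (bhi j))
    (μA : ℝ) (μB : Fin n → ℝ) :
    setDist (μA • A) (∑ j, μB j • B j) =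
      max 0 (|μA * ((alo + ahi) / 2) - ∑ j, μB j * ((blo j + bhi j) / 2)| -
        (|μA| * ((ahi - alo) / 2) + ∑ j, |μB j| * ((bhi j - blo j) / 2))) := by
  exact ((SymP.base hA hAconv hAconj hAproj).smul μA).setDist_eq
    (SymP.sum Finset.univ _ _ _ fun j =>
      (SymP.base (hB j) (hBconv j) (hBconj j) (hBproj j)).smul (μB j))
end
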